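/- Let M be a continuous martingale with M₀ = 0 and ⟨M⟩_t - ⟨M⟩_s ≤ c₁(t-s), let λ > 0, Z_t = ∫₀^t e^{-λ(t-s)} dM_s, T > 0 and ε ∈ (0,1). Then for each q > 1 there is a constant c₂(ε, q) such that for all 0 ≤ s₀ < t₀ ≤ T, E|Z_{t₀} - Z_{s₀}|^{2q} ≤ c₂(ε, q) (t₀ - s₀)^{εq} / λ^{(1-ε)q}. -/

import Mathlib

open Real MeasureTheory

/-- The stochastic convolution `Z_t = ∫₀^t e^{-λ(t-s)} dM_s`, written via
integration by parts as `M_t - λ ∫₀^t e^{-λ(t-s)} M_s ds`. -/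
noncomputable def ouConv {Ω : Type} (lam : ℝ) (M : ℝ → Ω → ℝ) (t : ℝ) (ω : Ω) : ℝ :=
  M t ω - lam * ∫ s in (0:ℝ)..t, Real.exp (-(lam * (t - s))) * M s ω

open Filter Topology

lemma aux_mart_zero {Ω : Type} {m : MeasurableSpace Ω} {μ : Measure Ω} [IsProbabilityMeasure μ]
    {ℱ : Filtration ℝ m} {f : ℝ → Ω → ℝ} (hf : Martingale f ℱ μ) {s t : ℝ} (hst : s ≤ t)
    {W : Ω → ℝ} (hW : StronglyMeasurable[ℱ s] W)
    (hi : Integrable (fun ω => W ω * (f t ω - f s ω)) μ) :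
    ∫ ω, W ω * (f t ω - f s ω) ∂μ = 0 := by
  have h1 : μ[fun ω => W ω * (f t ω - f s ω) | ℱ s] =ᵐ[μ] W * μ[fun ω => f t ω - f s ω | ℱ s] :=
    condExp_mul_of_stronglyMeasurable_left hW hi ((hf.integrable t).sub (hf.integrable s))
  have h2 : μ[fun ω => f t ω - f s ω | ℱ s] =ᵐ[μ] μ[f t | ℱ s] - μ[f s | ℱ s] :=
    condExp_sub (hf.integrable t) (hf.integrable s) _
  have h3 := hf.condExp_ae_eq hst
  have h4 := hf.condExp_ae_eq (le_refl s)
  rw [← integral_condExp (ℱ.le s)]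
  rw [← integral_zero Ω ℝ (μ := μ)]
  apply integral_congr_ae
  filter_upwards [h1, h2, h3, h4] with ω a b c d
  simp [a, b, c, d]

lemma aux_int5 {Ω : Type} {m : MeasurableSpace Ω} {μ : Measure Ω} {a b c d e : Ω → ℝ}
    (ha : Integrable a μ) (hb : Integrable b μ) (hc : Integrable c μ) (hd : Integrable d μ)
    (he : Integrable e μ) : Integrable (fun x => a x + (b x + (c x + (d x + e x)))) μ ∧
    ∫ x, a x + (b x + (c x + (d x + e x))) ∂μ =
      ∫ x, a x ∂μ + (∫ x, b x ∂μ + (∫ x, c x ∂μ + (∫ x, d x ∂μ + ∫ x, e x ∂μ))) := by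
  have h1 : Integrable (fun x => d x + e x) μ := hd.add he
  have h2 : Integrable (fun x => c x + (d x + e x)) μ := hc.add h1
  have h3 : Integrable (fun x => b x + (c x + (d x + e x))) μ := hb.add h2
  exact ⟨ha.add h3, by
    rw [integral_add ha h3, integral_add hb h2, integral_add hc h1, integral_add hd he]⟩

/-- A continuous-time bundle of the hypotheses. -/
structure AuxH {Ω : Type} (m : MeasurableSpace Ω) (μ : Measure Ω) (ℱ : Filtration ℝ m)
    (M qv : ℝ → Ω → ℝ) (c : ℝ) : Prop where
  mart : Martingale M ℱ μ
  zero : ∀ ω, M 0 ω = 0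
  cont : ∀ ω, Continuous fun t => M t ω
  mart2 : Martingale (fun t ω => (M t ω) ^ 2 - qv t ω) ℱ μ
  inc : ∀ s t : ℝ, s ≤ t → ∀ ω, qv t ω - qv s ω ≤ c * (t - s)

section
set_option linter.unusedSectionVars false
variable {Ω : Type} {m : MeasurableSpace Ω} {μ : Measure Ω} [IsProbabilityMeasure μ]
    {ℱ : Filtration ℝ m} {M qv : ℝ → Ω → ℝ} {c : ℝ}

lemma AuxH.meas (H : AuxH m μ ℱ M qv c) (t : ℝ) : StronglyMeasurable (M t) :=
  H.mart.stronglyMeasurable t |>.mono (ℱ.le t)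

lemma AuxH.sq_int (H : AuxH m μ ℱ M qv c) {t : ℝ} (ht : 0 ≤ t) :
    Integrable (fun ω => (M t ω) ^ 2) μ := by
  have h0 := H.mart2.integrable 0
  have h1 := H.mart2.integrable t
  refine Integrable.mono' ((h1.sub h0).add (integrable_const (c * (t - 0))))
    ((H.meas t).pow 2).aestronglyMeasurable (Eventually.of_forall fun ω => ?_)
  have := H.inc 0 t ht ω
  have h := H.zero ω
  simp only [Real.norm_eq_abs, abs_of_nonneg (sq_nonneg (M t ω)), Pi.add_apply, Pi.sub_apply, h]
  nlinarith

lemma AuxH.memLp (H : AuxH m μ ℱ M qv c) {t : ℝ} (ht : 0 ≤ t) : MemLp (M t) 2 μ :=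
  (memLp_two_iff_integrable_sq (H.meas t).aestronglyMeasurable).2 (H.sq_int ht)

lemma AuxH.qv_meas (H : AuxH m μ ℱ M qv c) (t : ℝ) : StronglyMeasurable (qv t) := by
  have h := (H.mart2.stronglyMeasurable t).mono (ℱ.le t)
  have := ((H.meas t).pow 2).sub h
  convert this using 1
  ext ω; simp

lemma AuxH.step (H : AuxH m μ ℱ M qv c) {s t : ℝ} (hs : 0 ≤ s) (hst : s ≤ t)
    {W : Ω → ℝ} (hW : StronglyMeasurable[ℱ s] W) (h0 : ∀ ω, 0 ≤ W ω) {B : ℝ}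
    (hB : ∀ ω, W ω ≤ B) (θ : ℝ) :
    Integrable (fun ω => W ω * (1 + θ * (M t ω - M s ω) + (θ * (M t ω - M s ω)) ^ 2)) μ ∧
    ∫ ω, W ω * (1 + θ * (M t ω - M s ω) + (θ * (M t ω - M s ω)) ^ 2) ∂μ
      ≤ (1 + θ ^ 2 * (c * (t - s))) * ∫ ω, W ω ∂μ := by
  have ht : 0 ≤ t := hs.trans hst
  have hWm : AEStronglyMeasurable W μ := (hW.mono (ℱ.le s)).aestronglyMeasurable
  have hWb : ∀ᵐ ω ∂μ, ‖W ω‖ ≤ B := Eventually.of_forall fun ω => by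
    rw [Real.norm_eq_abs, abs_of_nonneg (h0 ω)]; exact hB ω
  have hbd : ∀ g : Ω → ℝ, Integrable g μ → Integrable (fun ω => W ω * g ω) μ :=
    fun g hg => hg.bdd_mul hWm hWb
  have hWi : Integrable W μ := by simpa using hbd (fun _ => 1) (integrable_const 1)
  have i1 : Integrable (fun ω => W ω * (M t ω - M s ω)) μ := hbd _ ((H.mart.integrable t).sub (H.mart.integrable s))
  have i2 : Integrable (fun ω => W ω * ((M t ω ^ 2 - qv t ω) - (M s ω ^ 2 - qv s ω))) μ := hbd _ ((H.mart2.integrable t).sub (H.mart2.integrable s))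
  have imul : Integrable (fun ω => M s ω * (M t ω - M s ω)) μ :=
    (H.memLp hs).integrable_mul ((H.memLp ht).sub (H.memLp hs))
  have i3 := hbd _ imul
  have hq : Integrable (fun ω => qv t ω - qv s ω) μ := by
    have := ((H.sq_int ht).sub (H.sq_int hs)).sub
      ((H.mart2.integrable t).sub (H.mart2.integrable s))
    refine this.congr (Eventually.of_forall fun ω => ?_)
    simp; ring
  have i4 := hbd _ hq
  have e1 : ∫ ω, W ω * (M t ω - M s ω) ∂μ = 0 := aux_mart_zero H.mart hst hW i1
  have e2 := aux_mart_zero H.mart2 hst hW i2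
  have e3 : ∫ ω, W ω * (M s ω * (M t ω - M s ω)) ∂μ = 0 := by
    have := aux_mart_zero H.mart hst (W := fun ω => W ω * M s ω)
      (hW.mul (H.mart.stronglyMeasurable s)) (by simpa only [mul_assoc] using i3)
    simpa only [mul_assoc] using this
  have e4 : ∫ ω, W ω * (qv t ω - qv s ω) ∂μ ≤ (c * (t - s)) * ∫ ω, W ω ∂μ := by
    rw [← integral_const_mul]
    refine integral_mono i4 (hWi.const_mul _) fun ω => ?_
    have := mul_le_mul_of_nonneg_left (H.inc s t hst ω) (h0 ω)
    simp only; linarith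
  have key : (fun ω => W ω * (1 + θ * (M t ω - M s ω) + (θ * (M t ω - M s ω)) ^ 2)) =
      fun ω => W ω + (θ * (W ω * (M t ω - M s ω)) +
        (θ ^ 2 * (W ω * ((M t ω ^ 2 - qv t ω) - (M s ω ^ 2 - qv s ω))) +
        (θ ^ 2 * (W ω * (qv t ω - qv s ω)) +
        (-2 * θ ^ 2) * (W ω * (M s ω * (M t ω - M s ω)))))) := by
    ext ω; ring
  rw [key]
  have j1 := i1.const_mul θ
  have j2 := i2.const_mul (θ ^ 2)
  have j3 := i3.const_mul (-2 * θ ^ 2)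
  have j4 := i4.const_mul (θ ^ 2)
  obtain ⟨k1, k2⟩ := aux_int5 hWi j1 j2 j4 j3
  refine ⟨k1, ?_⟩
  rw [k2]
  simp only [integral_const_mul]
  rw [e1, e3]
  rw [e2]
  nlinarith [mul_le_mul_of_nonneg_left e4 (sq_nonneg θ)]

/-- truncated exponential -/
noncomputable def tExp (x : ℝ) : ℝ := if |x| ≤ 1 then Real.exp x else 0

lemma tExp_nonneg (x : ℝ) : 0 ≤ tExp x := by
  unfold tExp; split_ifs <;> positivity

lemma tExp_le (x : ℝ) : tExp x ≤ 1 + x + x ^ 2 := by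
  unfold tExp; split_ifs with h
  · have := abs_le.1 (Real.abs_exp_sub_one_sub_id_le h); linarith [this.2]
  · nlinarith [sq_nonneg (x + 1), sq_nonneg x]

lemma tExp_le' (x : ℝ) : tExp x ≤ Real.exp 1 := by
  unfold tExp; split_ifs with h
  · exact Real.exp_le_exp.2 (abs_le.1 h).2
  · positivity

lemma tExp_meas : Measurable tExp :=
  Measurable.ite (measurableSet_le (by fun_prop) measurable_const) (by fun_prop) measurable_const

noncomputable def auxW (M : ℝ → Ω → ℝ) (θ s d : ℝ) (n : ℕ) (ω : Ω) : ℝ :=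
  ∏ j ∈ Finset.range n, tExp (θ * (M (s + (j + 1 : ℕ) * d) ω - M (s + j * d) ω))

lemma AuxH.W_bound (H : AuxH m μ ℱ M qv c) {s d : ℝ} (hs : 0 ≤ s) (hd : 0 ≤ d) (hc : 0 ≤ c)
    (θ : ℝ) (n : ℕ) :
    StronglyMeasurable[ℱ (s + n * d)] (auxW M θ s d n) ∧ (∀ ω, 0 ≤ auxW M θ s d n ω) ∧
    (∀ ω, auxW M θ s d n ω ≤ Real.exp 1 ^ n) ∧
    ∫ ω, auxW M θ s d n ω ∂μ ≤ (1 + θ ^ 2 * (c * d)) ^ n := by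
  induction n with
  | zero =>
    refine ⟨?_, ?_, ?_, ?_⟩
    · have : auxW M θ s d 0 = fun _ => 1 := by ext ω; simp [auxW]
      rw [this]; exact stronglyMeasurable_const
    all_goals simp [auxW]
  | succ n ih =>
    obtain ⟨a1, a2, a3, a4⟩ := ih
    have hle : s + n * d ≤ s + (n + 1 : ℕ) * d := by push_cast; nlinarith
    have hsn : 0 ≤ s + n * d := by positivity
    have hrec : auxW M θ s d (n + 1) = fun ω => auxW M θ s d n ω *
        tExp (θ * (M (s + (n + 1 : ℕ) * d) ω - M (s + n * d) ω)) := by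
      ext ω; simp [auxW, Finset.prod_range_succ]
    have hm : StronglyMeasurable[ℱ (s + (n + 1 : ℕ) * d)] (auxW M θ s d (n + 1)) := by
      rw [hrec]
      refine (a1.mono (ℱ.mono hle)).mul ?_
      have h1 := H.mart.stronglyMeasurable (s + (n + 1 : ℕ) * d)
      have h2 := (H.mart.stronglyMeasurable (s + n * d)).mono (ℱ.mono hle)
      exact (tExp_meas.comp ((h1.sub h2).const_mul θ).measurable).stronglyMeasurable
    have hn : ∀ ω, 0 ≤ auxW M θ s d (n + 1) ω := fun ω => by
      rw [hrec]; exact mul_nonneg (a2 ω) (tExp_nonneg _)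
    have hb : ∀ ω, auxW M θ s d (n + 1) ω ≤ Real.exp 1 ^ (n + 1) := fun ω => by
      rw [hrec, pow_succ]
      exact mul_le_mul (a3 ω) (tExp_le' _) (tExp_nonneg _) (by positivity)
    refine ⟨hm, hn, hb, ?_⟩
    obtain ⟨b1, b2⟩ := H.step hsn hle a1 a2 a3 θ
    calc ∫ ω, auxW M θ s d (n + 1) ω ∂μ ≤ _ := integral_mono_of_nonneg
          (Eventually.of_forall hn) b1 (Eventually.of_forall fun ω => by
            rw [hrec]; exact mul_le_mul_of_nonneg_left (tExp_le _) (a2 ω))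
      _ ≤ _ := b2
      _ = (1 + θ ^ 2 * (c * d)) * ∫ ω, auxW M θ s d n ω ∂μ := by
        congr 4; push_cast; ring
      _ ≤ (1 + θ ^ 2 * (c * d)) * (1 + θ ^ 2 * (c * d)) ^ n :=
        mul_le_mul_of_nonneg_left a4 (by positivity)
      _ = _ := by ring

lemma AuxH.W_lim (H : AuxH m μ ℱ M qv c) {s t : ℝ} (hst : s ≤ t) (θ : ℝ) (ω : Ω) :
    ∀ᶠ n : ℕ in atTop, auxW M θ s ((t - s) / n) n ω = Real.exp (θ * (M t ω - M s ω)) := by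
  have hc : ContinuousOn (fun r => θ * M r ω) (Set.Icc s t) :=
    (continuous_const.mul (H.cont ω)).continuousOn
  have hu := isCompact_Icc.uniformContinuousOn_of_continuous hc
  rw [Metric.uniformContinuousOn_iff] at hu
  obtain ⟨δ, hδ, hu⟩ := hu 1 one_pos
  have hlim : Tendsto (fun n : ℕ => (t - s) / n) atTop (𝓝 0) :=
    tendsto_const_div_atTop_nhds_zero_nat _
  filter_upwards [hlim.eventually (gt_mem_nhds hδ), eventually_gt_atTop 0] with n hn hn0
  have hn0' : (0 : ℝ) < n := by exact_mod_cast hn0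
  set d := (t - s) / n with hd
  have hd0 : 0 ≤ d := div_nonneg (by linarith) hn0'.le
  have hnd : n * d = t - s := by rw [hd]; field_simp
  have hmem : ∀ j : ℕ, j ≤ n → s + j * d ∈ Set.Icc s t := fun j hj => by
    have : (j : ℝ) * d ≤ n * d := mul_le_mul_of_nonneg_right (by exact_mod_cast hj) hd0
    exact ⟨by nlinarith [mul_nonneg (Nat.cast_nonneg (α := ℝ) j) hd0], by linarith⟩
  have : auxW M θ s d n ω = ∏ j ∈ Finset.range n,
      Real.exp (θ * (M (s + (j + 1 : ℕ) * d) ω - M (s + j * d) ω)) := by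
    refine Finset.prod_congr rfl fun j hj => ?_
    have hj' := Finset.mem_range.1 hj
    have := hu _ (hmem (j + 1) hj') _ (hmem j hj'.le) (by
      rw [Real.dist_eq]; push_cast
      rw [show s + (j + 1) * d - (s + j * d) = d by ring, abs_of_nonneg hd0]; exact hn)
    rw [Real.dist_eq, ← mul_sub] at this
    simp only [tExp]
    rw [if_pos this.le]
  rw [this, ← Real.exp_sum, ← Finset.mul_sum,
    Finset.sum_range_sub (fun j : ℕ => M (s + j * d) ω)]
  simp [hnd]

lemma AuxH.exp_bound (H : AuxH m μ ℱ M qv c) (hc : 0 ≤ c) {s t : ℝ} (hs : 0 ≤ s) (hst : s ≤ t)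
    (θ : ℝ) :
    ∫⁻ ω, ENNReal.ofReal (Real.exp (θ * (M t ω - M s ω))) ∂μ ≤
      ENNReal.ofReal (Real.exp (θ ^ 2 * (c * (t - s)))) := by
  have hd : ∀ n : ℕ, 0 ≤ (t - s) / n := fun n => div_nonneg (by linarith) n.cast_nonneg
  have hW := fun n : ℕ => H.W_bound hs (hd n) hc θ n
  have e : ∀ ω, ENNReal.ofReal (Real.exp (θ * (M t ω - M s ω))) =
      liminf (fun n : ℕ => ENNReal.ofReal (auxW M θ s ((t - s) / n) n ω)) atTop := fun ω => by
    have : Tendsto (fun n : ℕ => ENNReal.ofReal (auxW M θ s ((t - s) / n) n ω)) atTop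
        (𝓝 (ENNReal.ofReal (Real.exp (θ * (M t ω - M s ω))))) :=
      tendsto_const_nhds.congr' ((H.W_lim hst θ ω).mono fun n hn => by simp only [hn])
    exact this.liminf_eq.symm
  simp_rw [e]
  refine (lintegral_liminf_le fun n => ?_).trans ?_
  · exact (((hW n).1.mono (ℱ.le _)).measurable).ennreal_ofReal
  · refine liminf_le_of_frequently_le' (Eventually.frequently ?_)
    filter_upwards [eventually_gt_atTop 0] with n hn0
    have hn0' : (0 : ℝ) < n := by exact_mod_cast hn0
    obtain ⟨a1, a2, a3, a4⟩ := hW n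
    have hi : Integrable (auxW M θ s ((t - s) / n) n) μ :=
      Integrable.mono' (integrable_const (Real.exp 1 ^ n))
        (a1.mono (ℱ.le _)).aestronglyMeasurable
        (Eventually.of_forall fun ω => by
          rw [Real.norm_eq_abs, abs_of_nonneg (a2 ω)]; exact a3 ω)
    rw [← ofReal_integral_eq_lintegral_ofReal hi (Eventually.of_forall a2)]
    refine ENNReal.ofReal_le_ofReal (a4.trans ?_)
    have hx : 0 ≤ θ ^ 2 * (c * ((t - s) / n)) := by have := hd n; positivity
    calc (1 + θ ^ 2 * (c * ((t - s) / n))) ^ n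
        ≤ Real.exp (θ ^ 2 * (c * ((t - s) / n))) ^ n := by
          gcongr; linarith [Real.add_one_le_exp (θ ^ 2 * (c * ((t - s) / n)))]
      _ = _ := by rw [← Real.exp_nat_mul]; congr 1; field_simp

end

lemma rpow_le_exp_half {a y : ℝ} (ha : 0 ≤ a) (hy : 0 ≤ y) :
    y ^ a ≤ (2 * (a + 1)) ^ a * Real.exp (y / 2) := by
  have h1 : y ≤ 2 * (a + 1) * Real.exp (y / (2 * (a + 1))) := by
    have h := Real.add_one_le_exp (y / (2 * (a + 1)))
    have h2 : y = 2 * (a + 1) * (y / (2 * (a + 1))) := by field_simp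
    nlinarith
  calc y ^ a ≤ (2 * (a + 1) * Real.exp (y / (2 * (a + 1)))) ^ a := by gcongr
    _ = (2 * (a + 1)) ^ a * Real.exp (y / (2 * (a + 1)) * a) := by
      rw [Real.mul_rpow (by positivity) (by positivity), Real.exp_mul]
    _ ≤ _ := by
      gcongr
      rw [div_mul_eq_mul_div, div_le_div_iff₀ (by positivity) (by positivity)]
      nlinarith

/-- Moment bound for increments. -/
lemma AuxH.moment {c q : ℝ} (hc : 0 < c) (hq : 1 < q) : ∃ C : ℝ, 0 < C ∧
    ∀ {Ω : Type} {m : MeasurableSpace Ω} {μ : Measure Ω} [IsProbabilityMeasure μ]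
    {ℱ : Filtration ℝ m} {M qv : ℝ → Ω → ℝ}, AuxH m μ ℱ M qv c → ∀ {s t : ℝ}, 0 ≤ s → s ≤ t →
    ∫⁻ ω, ‖M t ω - M s ω‖ₑ ^ (2 * q) ∂μ ≤ ENNReal.ofReal (C * (t - s) ^ q) := by
  refine ⟨(2 * (2 * q + 1)) ^ (2 * q) * (2 * Real.exp 1) * c ^ q, by positivity, ?_⟩
  intro Ω m μ _ ℱ M qv H s t hs hst
  rcases hst.eq_or_lt with rfl | hlt
  · have : (0:ℝ) < 2 * q := by linarith
    simp [ENNReal.zero_rpow_of_pos this]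
  set V := c * (t - s) with hV
  have hV0 : 0 < V := mul_pos hc (by linarith)
  set θ := (√V)⁻¹ with hθ
  have hθ0 : 0 < θ := by positivity
  have hθ2 : θ ^ 2 * V = 1 := by rw [hθ, inv_pow, Real.sq_sqrt hV0.le]; field_simp
  set K := (2 * (2 * q + 1)) ^ (2 * q) with hK
  have hK0 : 0 ≤ K := by positivity
  have hpt : ∀ x : ℝ, ‖x‖ₑ ^ (2 * q) ≤ ENNReal.ofReal (V ^ q * K) *
      (ENNReal.ofReal (Real.exp (θ * x)) + ENNReal.ofReal (Real.exp (-θ * x))) := fun x => by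
    rw [← ENNReal.ofReal_add (by positivity) (by positivity), ← ENNReal.ofReal_mul (by positivity),
      Real.enorm_eq_ofReal_abs, ENNReal.ofReal_rpow_of_nonneg (abs_nonneg _) (by linarith)]
    apply ENNReal.ofReal_le_ofReal
    have h1 := rpow_le_exp_half (a := 2 * q) (y := θ * |x|) (by linarith) (by positivity)
    have h2 : Real.exp (θ * |x| / 2) ≤ Real.exp (θ * x) + Real.exp (-θ * x) := by
      have : Real.exp (θ * |x| / 2) ≤ Real.exp (θ * |x|) := Real.exp_le_exp.2 (by
        have : 0 ≤ θ * |x| := by positivity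
        linarith)
      refine this.trans ?_
      rcases abs_cases x with ⟨h, _⟩ | ⟨h, _⟩ <;> rw [h]
      · linarith [Real.exp_pos (-θ * x)]
      · rw [show θ * -x = -θ * x by ring]; linarith [Real.exp_pos (θ * x)]
    have h3 : |x| ^ (2 * q) = V ^ q * (θ * |x|) ^ (2 * q) := by
      rw [Real.mul_rpow hθ0.le (abs_nonneg _), ← mul_assoc, Real.rpow_mul hθ0.le,
        ← Real.mul_rpow hV0.le (by positivity)]
      rw [Real.rpow_two, mul_comm V, hθ2]; simp
    rw [h3, mul_assoc]
    gcongr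
    exact h1.trans (by gcongr)
  have hm : ∀ η : ℝ, Measurable fun ω => ENNReal.ofReal (Real.exp (η * (M t ω - M s ω))) :=
    fun η => by
      have := (H.meas t).measurable
      have := (H.meas s).measurable
      fun_prop
  calc ∫⁻ ω, ‖M t ω - M s ω‖ₑ ^ (2 * q) ∂μ ≤ _ := lintegral_mono fun ω => hpt _
    _ = ENNReal.ofReal (V ^ q * K) *
        (∫⁻ ω, ENNReal.ofReal (Real.exp (θ * (M t ω - M s ω))) ∂μ +
         ∫⁻ ω, ENNReal.ofReal (Real.exp (-θ * (M t ω - M s ω))) ∂μ) := by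
      rw [lintegral_const_mul' _ _ ENNReal.ofReal_ne_top, lintegral_add_left (hm θ)]
    _ ≤ ENNReal.ofReal (V ^ q * K) * (ENNReal.ofReal (Real.exp 1) + ENNReal.ofReal (Real.exp 1)) := by
      have a := H.exp_bound hc.le hs hst θ
      have b := H.exp_bound hc.le hs hst (-θ)
      rw [neg_sq] at b
      rw [← hV, hθ2] at a b
      gcongr
    _ = _ := by
      rw [← ENNReal.ofReal_add (by positivity) (by positivity), ← ENNReal.ofReal_mul (by positivity)]
      congr 1
      rw [hV, Real.mul_rpow hc.le (by linarith)]; ring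

lemma aux_jensen {α : Type} [MeasurableSpace α] {ν : Measure α} {w g : α → ENNReal}
    (hw : Measurable w) (hg : Measurable g) {p : ℝ} (hp : 1 < p) (h1 : ∫⁻ x, w x ∂ν ≤ 1) :
    (∫⁻ x, w x * g x ∂ν) ^ p ≤ ∫⁻ x, w x * g x ^ p ∂ν := by
  have hpq := Real.HolderConjugate.conjExponent hp
  set p' := Real.conjExponent p
  have hp0 : 0 < p := by linarith
  have hp'0 : 0 < p' := hpq.symm.pos
  have hH := ENNReal.lintegral_mul_le_Lp_mul_Lq ν hpq
    (f := fun x => w x ^ (1 / p) * g x) (g := fun x => w x ^ (1 / p'))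
    (by fun_prop) (by fun_prop)
  have e1 : ∀ x, ((fun x => w x ^ (1 / p) * g x) * fun x => w x ^ (1 / p')) x = w x * g x := by
    intro x
    simp only [Pi.mul_apply]
    rw [mul_right_comm, ← ENNReal.rpow_add_of_nonneg _ _ (by positivity) (by positivity)]
    have : 1 / p + 1 / p' = 1 := by simpa using hpq.inv_add_inv_eq_one
    rw [this, ENNReal.rpow_one]
  have e2 : ∀ x, (w x ^ (1 / p) * g x) ^ p = w x * g x ^ p := by
    intro x
    rw [ENNReal.mul_rpow_of_nonneg _ _ hp0.le, ← ENNReal.rpow_mul, one_div_mul_cancel hp0.ne',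
      ENNReal.rpow_one]
  have e3 : ∀ x, (w x ^ (1 / p')) ^ p' = w x := by
    intro x
    rw [← ENNReal.rpow_mul, one_div_mul_cancel hp'0.ne', ENNReal.rpow_one]
  simp_rw [e1, e2, e3] at hH
  have h2 : (∫⁻ x, w x ∂ν) ^ (1 / p') ≤ 1 := ENNReal.rpow_le_one h1 (by positivity)
  have h3 : ∫⁻ x, w x * g x ∂ν ≤ (∫⁻ x, w x * g x ^ p ∂ν) ^ (1 / p) :=
    hH.trans (by simpa using mul_le_mul_right h2 ((∫⁻ x, w x * g x ^ p ∂ν) ^ (1 / p)))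
  calc _ ≤ ((∫⁻ x, w x * g x ^ p ∂ν) ^ (1 / p)) ^ p := ENNReal.rpow_le_rpow h3 hp0.le
    _ = _ := by rw [← ENNReal.rpow_mul, one_div_mul_cancel hp0.ne', ENNReal.rpow_one]

lemma aux_weight (b s t : ℝ) :
    ∫ r in s..t, b * Real.exp (-(b * (t - r))) = 1 - Real.exp (-(b * (t - s))) := by
  have : ∀ r ∈ Set.uIcc s t, HasDerivAt (fun r => Real.exp (-(b * (t - r))))
      (b * Real.exp (-(b * (t - r)))) r := fun r _ => by
    have h1 : HasDerivAt (fun r => -(b * (t - r))) b r := by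
      have := (((hasDerivAt_id r).const_sub t).const_mul b).fun_neg
      simpa using this
    simpa [mul_comm] using h1.exp
  rw [intervalIntegral.integral_eq_sub_of_hasDerivAt this
    ((by fun_prop : Continuous _).intervalIntegrable _ _)]
  simp

lemma aux_weight_lint {b s t : ℝ} (hb : 0 < b) (hst : s ≤ t) :
    ∫⁻ r in Set.Ioc s t, ENNReal.ofReal (b * Real.exp (-(b * (t - r)))) ≤ 1 := by
  rw [← ofReal_integral_eq_lintegral_ofReal]
  · rw [← intervalIntegral.integral_of_le hst, aux_weight]
    rw [ENNReal.ofReal_le_one]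
    linarith [Real.exp_pos (-(b * (t - s)))]
  · exact (Continuous.integrableOn_Ioc (by fun_prop))
  · exact Eventually.of_forall fun r => by positivity

noncomputable def auxU {Ω : Type} (lam : ℝ) (M : ℝ → Ω → ℝ) (s t : ℝ) (ω : Ω) : ℝ :=
  Real.exp (-(lam * (t - s))) * (M t ω - M s ω) +
    ∫ r in s..t, lam * Real.exp (-(lam * (t - r))) * (M t ω - M r ω)

lemma aux_ident {Ω : Type} (lam : ℝ) (M : ℝ → Ω → ℝ) (s t : ℝ) (ω : Ω)
    (hc : Continuous fun t => M t ω) :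
    ouConv lam M t ω - Real.exp (-(lam * (t - s))) * ouConv lam M s ω = auxU lam M s t ω := by
  have hI : ∀ a b u : ℝ, IntervalIntegrable
      (fun r => Real.exp (-(lam * (u - r))) * M r ω) volume a b := fun a b u =>
    (by fun_prop : Continuous _).intervalIntegrable _ _
  have h1 : ∫ r in (0:ℝ)..t, Real.exp (-(lam * (t - r))) * M r ω =
      (∫ r in (0:ℝ)..s, Real.exp (-(lam * (t - r))) * M r ω) +
      ∫ r in s..t, Real.exp (-(lam * (t - r))) * M r ω :=
    (intervalIntegral.integral_add_adjacent_intervals (hI _ _ _) (hI _ _ _)).symm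
  have h2 : ∫ r in (0:ℝ)..s, Real.exp (-(lam * (t - r))) * M r ω =
      Real.exp (-(lam * (t - s))) * ∫ r in (0:ℝ)..s, Real.exp (-(lam * (s - r))) * M r ω := by
    rw [← intervalIntegral.integral_const_mul]
    congr 1; ext r
    rw [← mul_assoc, ← Real.exp_add]; congr 2; ring
  have h3 : ∫ r in s..t, lam * Real.exp (-(lam * (t - r))) * (M t ω - M r ω) =
      M t ω * (1 - Real.exp (-(lam * (t - s)))) -
      lam * ∫ r in s..t, Real.exp (-(lam * (t - r))) * M r ω := by
    rw [← aux_weight, ← intervalIntegral.integral_const_mul, ← intervalIntegral.integral_const_mul,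
      ← intervalIntegral.integral_sub]
    · congr 1; ext r; ring
    · exact (by fun_prop : Continuous _).intervalIntegrable _ _
    · exact (by fun_prop : Continuous _).intervalIntegrable _ _
  unfold auxU ouConv
  rw [h3, h1, h2]; ring

lemma aux_real_split {lam u h ε q C : ℝ} (hlam : 0 < lam) (hu : 0 ≤ u) (huh : u ≤ h)
    (hε0 : 0 ≤ ε) (hε1 : ε ≤ 1) (hq : 1 < q) (hC : 0 < C) :
    C * u ^ q ≤ (2 * ((1 - ε) * q + 1)) ^ ((1 - ε) * q) * C * h ^ (ε * q) / lam ^ ((1 - ε) * q) *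
      Real.exp (lam * u / 2) := by
  set a := (1 - ε) * q with ha
  have ha0 : 0 ≤ a := mul_nonneg (by linarith) (by linarith)
  have hεq : 0 ≤ ε * q := mul_nonneg hε0 (by linarith)
  have h1 : u ^ q = u ^ (ε * q) * u ^ a := by
    rw [← Real.rpow_add_of_nonneg hu hεq ha0]; congr 1; rw [ha]; ring
  have h2 : u ^ a ≤ (2 * (a + 1)) ^ a * Real.exp (lam * u / 2) / lam ^ a := by
    rw [le_div_iff₀ (by positivity), mul_comm, ← Real.mul_rpow hlam.le hu]
    exact rpow_le_exp_half ha0 (by positivity)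
  have h3 : u ^ (ε * q) ≤ h ^ (ε * q) := Real.rpow_le_rpow hu huh hεq
  calc C * u ^ q = C * (u ^ (ε * q) * u ^ a) := by rw [h1]
    _ ≤ C * (h ^ (ε * q) * ((2 * (a + 1)) ^ a * Real.exp (lam * u / 2) / lam ^ a)) := by
      have : 0 ≤ h := hu.trans huh
      gcongr
    _ = _ := by ring

lemma AuxH.U_bound {c ε q : ℝ} (hc : 0 < c) (hq : 1 < q) (hε0 : 0 ≤ ε) (hε1 : ε ≤ 1) :
    ∃ C : ℝ, 0 < C ∧
    ∀ {Ω : Type} {m : MeasurableSpace Ω} {μ : Measure Ω} [IsProbabilityMeasure μ]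
    {ℱ : Filtration ℝ m} {M qv : ℝ → Ω → ℝ}, AuxH m μ ℱ M qv c → ∀ {lam s t : ℝ}, 0 < lam →
    0 ≤ s → s ≤ t →
    ∫⁻ ω, ‖auxU lam M s t ω‖ₑ ^ (2 * q) ∂μ ≤
      ENNReal.ofReal (C * (t - s) ^ (ε * q) / lam ^ ((1 - ε) * q)) := by
  obtain ⟨C, hC, hmom⟩ := AuxH.moment hc hq
  set K := (2 * ((1 - ε) * q + 1)) ^ ((1 - ε) * q) * C with hK
  have ha0 : 0 ≤ (1 - ε) * q := mul_nonneg (by linarith) (by linarith)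
  have hK0 : 0 < K := by positivity
  refine ⟨2 ^ (2 * q - 1) * (3 * K), by positivity, ?_⟩
  intro Ω m μ _ ℱ M qv H lam s t hlam hs hst
  set B := K * (t - s) ^ (ε * q) / lam ^ ((1 - ε) * q) with hB
  have hts : 0 ≤ t - s := by linarith
  have hB0 : 0 ≤ B := by positivity
  have hp : 1 < 2 * q := by linarith
  have hMm : Measurable (Function.uncurry M) :=
    measurable_uncurry_of_continuous_of_measurable (fun ω => H.cont ω)
      (fun t => (H.meas t).measurable)
  have hMm2 : Measurable fun z : ℝ × Ω => M z.1 z.2 := hMm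
  have hMt := (H.meas t).measurable
  have hMs := (H.meas s).measurable
  -- first term
  have T1 : ∫⁻ ω, ‖Real.exp (-(lam * (t - s))) * (M t ω - M s ω)‖ₑ ^ (2 * q) ∂μ ≤
      ENNReal.ofReal B := by
    have e : ∀ ω, ‖Real.exp (-(lam * (t - s))) * (M t ω - M s ω)‖ₑ ^ (2 * q) =
        ENNReal.ofReal (Real.exp (-(lam * (t - s)) * (2 * q))) * ‖M t ω - M s ω‖ₑ ^ (2 * q) := by
      intro ω
      rw [enorm_mul, ENNReal.mul_rpow_of_nonneg _ _ (by linarith), Real.enorm_eq_ofReal_abs,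
        abs_of_pos (Real.exp_pos _), ENNReal.ofReal_rpow_of_nonneg (Real.exp_pos _).le (by linarith),
        Real.exp_mul]
    simp_rw [e]
    rw [lintegral_const_mul' _ _ ENNReal.ofReal_ne_top]
    calc _ ≤ ENNReal.ofReal (Real.exp (-(lam * (t - s)) * (2 * q))) *
          ENNReal.ofReal (C * (t - s) ^ q) := by gcongr; exact hmom H hs hst
      _ ≤ _ := by
        rw [← ENNReal.ofReal_mul (by positivity)]
        apply ENNReal.ofReal_le_ofReal
        have := aux_real_split (C := C) hlam hts le_rfl hε0 hε1 hq hC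
        calc _ ≤ Real.exp (-(lam * (t - s)) * (2 * q)) * (B * Real.exp (lam * (t - s) / 2)) := by
              gcongr
          _ = B * Real.exp (-(lam * (t - s)) * (2 * q) + lam * (t - s) / 2) := by
              rw [Real.exp_add]; ring
          _ ≤ B * 1 := by
              gcongr
              rw [Real.exp_le_one_iff]
              have : 0 ≤ lam * (t - s) := by positivity
              nlinarith
          _ = B := mul_one _
  -- second term
  have T2 : ∫⁻ ω, ‖∫ r in s..t, lam * Real.exp (-(lam * (t - r))) * (M t ω - M r ω)‖ₑ ^ (2 * q) ∂μ
      ≤ ENNReal.ofReal (2 * B) := by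
    calc _ ≤ ∫⁻ ω, (∫⁻ r in Set.Ioc s t, ENNReal.ofReal (lam * Real.exp (-(lam * (t - r)))) *
            ‖M t ω - M r ω‖ₑ) ^ (2 * q) ∂μ := by
          refine lintegral_mono fun ω => ENNReal.rpow_le_rpow ?_ (by linarith)
          rw [intervalIntegral.integral_of_le hst]
          refine (enorm_integral_le_lintegral_enorm _).trans (le_of_eq ?_)
          congr 1; ext r
          rw [enorm_mul, Real.enorm_eq_ofReal_abs, abs_of_nonneg (by positivity)]
      _ ≤ ∫⁻ ω, (∫⁻ r in Set.Ioc s t, ENNReal.ofReal (lam * Real.exp (-(lam * (t - r)))) *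
            ‖M t ω - M r ω‖ₑ ^ (2 * q)) ∂μ := by
          refine lintegral_mono fun ω => ?_
          have := H.cont ω
          exact aux_jensen (by fun_prop) (by fun_prop) hp (aux_weight_lint hlam hst)
      _ = ∫⁻ r in Set.Ioc s t, (∫⁻ ω, ENNReal.ofReal (lam * Real.exp (-(lam * (t - r)))) *
            ‖M t ω - M r ω‖ₑ ^ (2 * q) ∂μ) := by
          refine lintegral_lintegral_swap (Measurable.aemeasurable ?_)
          have h1 : Measurable fun z : Ω × ℝ => M z.2 z.1 := hMm2.comp measurable_swap
          have h2 : Measurable fun z : Ω × ℝ => M t z.1 := hMt.comp measurable_fst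
          simp only [Function.uncurry_def]
          fun_prop
      _ ≤ ∫⁻ r in Set.Ioc s t, ENNReal.ofReal (2 * B) *
            ENNReal.ofReal (lam / 2 * Real.exp (-(lam / 2 * (t - r)))) := by
          refine setLIntegral_mono' measurableSet_Ioc fun r hr => ?_
          rw [lintegral_const_mul' _ _ ENNReal.ofReal_ne_top]
          have hrt : 0 ≤ t - r := by linarith [hr.2]
          calc _ ≤ ENNReal.ofReal (lam * Real.exp (-(lam * (t - r)))) *
                ENNReal.ofReal (C * (t - r) ^ q) := by
                gcongr; exact hmom H (hs.trans hr.1.le) hr.2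
            _ ≤ _ := by
              rw [← ENNReal.ofReal_mul (by positivity), ← ENNReal.ofReal_mul (by positivity)]
              apply ENNReal.ofReal_le_ofReal
              have := aux_real_split (C := C) hlam hrt (by linarith [hr.1] : t - r ≤ t - s)
                hε0 hε1 hq hC
              calc _ ≤ lam * Real.exp (-(lam * (t - r))) *
                    (B * Real.exp (lam * (t - r) / 2)) := by gcongr
                _ = lam * B * Real.exp (-(lam * (t - r)) + lam * (t - r) / 2) := by
                    rw [Real.exp_add]; ring
                _ = lam * B * Real.exp (-(lam / 2 * (t - r))) := by congr 2; ring
                _ = _ := by ring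
      _ ≤ ENNReal.ofReal (2 * B) * 1 := by
          rw [lintegral_const_mul' _ _ ENNReal.ofReal_ne_top]
          gcongr
          exact aux_weight_lint (by linarith) hst
      _ = _ := mul_one _
  calc _ ≤ ∫⁻ ω, (2 : ENNReal) ^ (2 * q - 1) *
        (‖Real.exp (-(lam * (t - s))) * (M t ω - M s ω)‖ₑ ^ (2 * q) +
        ‖∫ r in s..t, lam * Real.exp (-(lam * (t - r))) * (M t ω - M r ω)‖ₑ ^ (2 * q)) ∂μ := by
        refine lintegral_mono fun ω => ?_
        refine (ENNReal.rpow_le_rpow (enorm_add_le _ _) (by linarith)).trans ?_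
        exact ENNReal.rpow_add_le_mul_rpow_add_rpow _ _ hp.le
    _ = (2 : ENNReal) ^ (2 * q - 1) * (_ + _) := by
        rw [lintegral_const_mul' _ _ (by finiteness), lintegral_add_left (by fun_prop)]
    _ ≤ (2 : ENNReal) ^ (2 * q - 1) * (ENNReal.ofReal B + ENNReal.ofReal (2 * B)) := by gcongr
    _ = _ := by
        rw [← ENNReal.ofReal_add hB0 (by positivity),
          show (2 : ENNReal) = ENNReal.ofReal 2 by simp,
          ENNReal.ofReal_rpow_of_pos two_pos, ← ENNReal.ofReal_mul (by positivity)]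
        congr 1
        rw [hB]; ring

/-- Moment bound (4.4)-type estimate for increments of the stochastic convolution:
for each `q > 1` there is `c₂(ε,q)` (also depending on `c₁, T`) with
`E|Z_{t₀} - Z_{s₀}|^{2q} ≤ c₂ (t₀-s₀)^{εq} / λ^{(1-ε)q}`. -/
theorem stmt7 (c₁ T ε q : ℝ) (hc₁ : 0 ≤ c₁) (hT : 0 < T)
    (hε : ε ∈ Set.Ioo (0:ℝ) 1) (hq : 1 < q) :
    ∃ c₂ : ℝ, 0 < c₂ ∧
      ∀ (Ω : Type) (m : MeasurableSpace Ω) (μ : Measure Ω),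
        IsProbabilityMeasure μ →
      ∀ (ℱ : Filtration ℝ m) (M qv : ℝ → Ω → ℝ),
        Martingale M ℱ μ →
        (∀ ω, M 0 ω = 0) →
        (∀ ω, Continuous fun t => M t ω) →
        Martingale (fun t ω => (M t ω) ^ 2 - qv t ω) ℱ μ →
        (∀ s t : ℝ, s ≤ t → ∀ ω, qv t ω - qv s ω ≤ c₁ * (t - s)) →
      ∀ (lam : ℝ), 0 < lam →
      ∀ s₀ t₀ : ℝ, 0 ≤ s₀ → s₀ < t₀ → t₀ ≤ T →
        (∫ ω, |ouConv lam M t₀ ω - ouConv lam M s₀ ω| ^ (2 * q) ∂μ) ≤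
          c₂ * (t₀ - s₀) ^ (ε * q) / lam ^ ((1 - ε) * q) := by
  have hε0 := hε.1
  have hε1 := hε.2
  have hc : 0 < c₁ + 1 := by linarith
  obtain ⟨C, hC, hU⟩ := AuxH.U_bound hc hq hε0.le hε1.le
  obtain ⟨C', hC', hU'⟩ := AuxH.U_bound (ε := 0) hc hq le_rfl zero_le_one
  refine ⟨2 ^ (2 * q - 1) * (C + C'), by positivity, ?_⟩
  intro Ω m μ _ ℱ M qv h1 h2 h3 h4 h5 lam hlam s t hs hst htT
  have H : AuxH m μ ℱ M qv (c₁ + 1) := ⟨h1, h2, h3, h4, fun a b hab ω => by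
    have := h5 a b hab ω
    nlinarith⟩
  have hts : 0 < t - s := by linarith
  have hp : 1 < 2 * q := by linarith
  set D := (t - s) ^ (ε * q) / lam ^ ((1 - ε) * q) with hD
  have hD0 : 0 ≤ D := by positivity
  have hZ0 : ∀ ω, ouConv lam M s ω = auxU lam M 0 s ω := fun ω => by
    rw [← aux_ident lam M 0 s ω (h3 ω)]
    simp [ouConv, h2 ω]
  set x := lam * (t - s) with hx
  have hx0 : 0 < x := by positivity
  set y := 1 - Real.exp (-x) with hy
  have hy0 : 0 ≤ y := by
    have : Real.exp (-x) ≤ 1 := Real.exp_le_one_iff.2 (by linarith)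
    linarith
  have hy1 : y ≤ 1 := by linarith [Real.exp_pos (-x)]
  have hyx : y ≤ x := by linarith [Real.add_one_le_exp (-x)]
  have hdec : ∀ ω, ouConv lam M t ω - ouConv lam M s ω =
      auxU lam M s t ω + (-y) * auxU lam M 0 s ω := fun ω => by
    rw [← aux_ident lam M s t ω (h3 ω), ← hZ0, hy, hx]; ring
  have hMm2 : Measurable fun z : Ω × ℝ => M z.2 z.1 := by
    have hMm : Measurable (Function.uncurry M) :=
      measurable_uncurry_of_continuous_of_measurable (fun ω => h3 ω)
        (fun t => (H.meas t).measurable)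
    exact hMm.comp measurable_swap
  have hOm : ∀ t, 0 ≤ t → Measurable (ouConv lam M t) := fun t ht => by
    unfold ouConv
    have hMt := (H.meas t).measurable
    simp_rw [intervalIntegral.integral_of_le ht]
    refine hMt.sub (Measurable.const_mul ?_ lam)
    refine StronglyMeasurable.measurable (StronglyMeasurable.integral_prod_right'
      (f := fun z : Ω × ℝ => Real.exp (-(lam * (t - z.2))) * M z.2 z.1) ?_)
    exact Measurable.stronglyMeasurable (Measurable.mul (by fun_prop) hMm2)
  have hmt := hOm t (by linarith)
  have hms := hOm s hs
  have hUm : Measurable (auxU lam M s t) := by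
    have : auxU lam M s t = fun ω => ouConv lam M t ω -
        Real.exp (-(lam * (t - s))) * ouConv lam M s ω := by
      ext ω; exact (aux_ident lam M s t ω (h3 ω)).symm
    rw [this]; fun_prop
  have hA := hU H hlam hs hst.le
  have hB : ∫⁻ ω, ‖(-y) * auxU lam M 0 s ω‖ₑ ^ (2 * q) ∂μ ≤ ENNReal.ofReal (C' * D) := by
    have e : ∀ ω, ‖(-y) * auxU lam M 0 s ω‖ₑ ^ (2 * q) =
        ENNReal.ofReal (y ^ (2 * q)) * ‖auxU lam M 0 s ω‖ₑ ^ (2 * q) := by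
      intro ω
      rw [enorm_mul, ENNReal.mul_rpow_of_nonneg _ _ (by linarith), enorm_neg,
        Real.enorm_eq_ofReal_abs,
        abs_of_nonneg hy0, ENNReal.ofReal_rpow_of_nonneg hy0 (by linarith)]
    simp_rw [e]
    rw [lintegral_const_mul' _ _ ENNReal.ofReal_ne_top]
    refine (mul_le_mul_right (hU' H hlam le_rfl hs) _).trans ?_
    rw [← ENNReal.ofReal_mul (by positivity)]
    apply ENNReal.ofReal_le_ofReal
    have hεq : 0 < ε * q := by positivity
    have hy2 : y ^ (2 * q) ≤ x ^ (ε * q) := by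
      calc y ^ (2 * q) ≤ y ^ (ε * q) :=
            Real.rpow_le_rpow_of_exponent_ge_of_imp hy0 hy1 (by nlinarith) (by
              intro _ h; linarith)
        _ ≤ _ := Real.rpow_le_rpow hy0 hyx hεq.le
    have hl : lam ^ q = lam ^ (ε * q) * lam ^ ((1 - ε) * q) := by
      rw [← Real.rpow_add hlam]; congr 1; ring
    simp only [zero_mul, Real.rpow_zero, mul_one, sub_zero, one_mul]
    calc y ^ (2 * q) * (C' / lam ^ q) ≤ x ^ (ε * q) * (C' / lam ^ q) := by gcongr
      _ = C' * D := by
        rw [hx, Real.mul_rpow hlam.le hts.le, hl, hD]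
        field_simp
  have hfin : ∫⁻ ω, ENNReal.ofReal (|ouConv lam M t ω - ouConv lam M s ω| ^ (2 * q)) ∂μ ≤
      ENNReal.ofReal (2 ^ (2 * q - 1) * (C + C') * D) := by
    calc _ ≤ ∫⁻ ω, (2 : ENNReal) ^ (2 * q - 1) *
        (‖auxU lam M s t ω‖ₑ ^ (2 * q) + ‖(-y) * auxU lam M 0 s ω‖ₑ ^ (2 * q)) ∂μ := by
          refine lintegral_mono fun ω => ?_
          rw [← ENNReal.ofReal_rpow_of_nonneg (abs_nonneg _) (by linarith),
            ← Real.enorm_eq_ofReal_abs, hdec]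
          refine (ENNReal.rpow_le_rpow (enorm_add_le _ _) (by linarith)).trans ?_
          exact ENNReal.rpow_add_le_mul_rpow_add_rpow _ _ hp.le
      _ = (2 : ENNReal) ^ (2 * q - 1) * (_ + _) := by
          rw [lintegral_const_mul' _ _ (by finiteness), lintegral_add_left (by fun_prop)]
      _ ≤ (2 : ENNReal) ^ (2 * q - 1) * (ENNReal.ofReal (C * D) + ENNReal.ofReal (C' * D)) := by
          gcongr
          rw [hD, ← mul_div_assoc]; exact hA
      _ = _ := by
          rw [← ENNReal.ofReal_add (by positivity) (by positivity),
            show (2 : ENNReal) = ENNReal.ofReal 2 by simp,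
            ENNReal.ofReal_rpow_of_pos two_pos, ← ENNReal.ofReal_mul (by positivity)]
          congr 1; ring
  rw [integral_eq_lintegral_of_nonneg_ae (Eventually.of_forall fun ω => by positivity)
    (Measurable.aestronglyMeasurable (by fun_prop)), mul_div_assoc]
  exact ENNReal.toReal_le_of_le_ofReal (by positivity) hfin
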